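/- arXiv:1306.1189 — 12 statements merged into one kernel-verified Lean document; each statement's English description precedes it below -/
import Mathlib

section
/- For every n ≥ 1, a binary block b₁b₂…b_{2n+1} of length 2n+1 is an n-step preimage of 1 under elementary cellular automaton rule 160 if and only if b_i = 1 for every odd index i. -/
/-- Block evolution operator of a radius-1 elementary CA local rule:
it maps a block `b₁…b_m` (`m ≥ 3`) to the block of length `m-2` whose
`i`-th symbol is `f b_i b_{i+1} b_{i+2}`. -/
def blockMap (f : Bool → Bool → Bool → Bool) : List Bool → List Bool
  | a :: b :: c :: rest => f a b c :: blockMap f (b :: c :: rest)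
  | _ => []

/-- Local rule 160: `f₁₆₀(x₁,x₂,x₃) = x₁·x₃`. -/
def f160 (x₁ _x₂ x₃ : Bool) : Bool := x₁ && x₃

theorem length_blockMap (f : Bool → Bool → Bool → Bool) (l : List Bool) :
    (blockMap f l).length = l.length - 2 := by
  induction l with
  | nil => rfl
  | cons a l ih =>
    rcases l with _ | ⟨b, _ | ⟨c, l⟩⟩
    · rfl
    · rfl
    · simp only [blockMap, List.length_cons] at ih ⊢
      omega

theorem getD_blockMap (f : Bool → Bool → Bool → Bool) (d : Bool) (l : List Bool) (i : ℕ)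
    (hi : i + 2 < l.length) :
    (blockMap f l).getD i d = f (l.getD i d) (l.getD (i + 1) d) (l.getD (i + 2) d) := by
  induction l generalizing i with
  | nil => simp at hi
  | cons a l ih =>
    rcases l with _ | ⟨b, _ | ⟨c, l⟩⟩
    · simp at hi
    · simp at hi
    · cases i with
      | zero => simp [blockMap]
      | succ i => simpa only [blockMap, List.getD_cons_succ] using ih i (by simpa using hi)

theorem iterate_blockMap_f160_eq_singleton_true_iff (n : ℕ) (l : List Bool)
    (hl : l.length = 2 * n + 1) :
    (blockMap f160)^[n] l = [true] ↔ ∀ k ≤ n, l.getD (2 * k) false = true := by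
  induction n generalizing l with
  | zero =>
    obtain ⟨a, rfl⟩ := List.length_eq_one_iff.mp hl
    simp
  | succ n ih =>
    rw [Function.iterate_succ_apply, ih _ (by rw [length_blockMap]; omega)]
    have step (k : ℕ) (hk : k ≤ n) : (blockMap f160 l).getD (2 * k) false = true ↔
        l.getD (2 * k) false = true ∧ l.getD (2 * (k + 1)) false = true := by
      rw [getD_blockMap f160 false l (2 * k) (by omega), f160, Bool.and_eq_true, mul_add_one]
    constructor
    · intro h k hk
      rcases Nat.le_succ_iff.mp hk with hk | rfl
      · exact ((step k hk).mp (h k hk)).1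
      · exact ((step n le_rfl).mp (h n le_rfl)).2
    · intro h k hk
      exact (step k hk).mpr ⟨h k (by omega), h (k + 1) (by omega)⟩

/-- For every `n ≥ 1`, a block `b₁b₂…b_{2n+1}` is an `n`-step preimage of `1`
under rule 160 if and only if `b_i = 1` for every odd (1-based) index `i`,
i.e. the entries at 0-based positions `0, 2, …, 2n` are all `1`. -/
theorem rule160_preimage_characterization (n : ℕ) (hn : 1 ≤ n)
    (b : Fin (2*n+1) → Bool) :
    (blockMap f160)^[n] (List.ofFn b) = [true] ↔
      ∀ i : Fin (n+1), b ⟨2 * i.val, by omega⟩ = true := by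
  rw [iterate_blockMap_f160_eq_singleton_true_iff n _ List.length_ofFn]
  have getD_ofFn (k : ℕ) (hk : k ≤ n) :
      (List.ofFn b).getD (2 * k) false = b ⟨2 * k, by omega⟩ := by
    rw [List.getD_eq_getElem _ _ (by rw [List.length_ofFn]; omega), List.getElem_ofFn]
  constructor
  · intro h i
    rw [← getD_ofFn i (by omega)]
    exact h i (by omega)
  · intro h k hk
    rw [getD_ofFn k hk]
    exact h ⟨k, by omega⟩
end

section
/- For every n ≥ 0, a binary block b of length 2n+1 is an n-step preimage of 1 under elementary cellular automaton rule 168 if and only if b ∈ A_n ∪ B_n, where: B_n is the set of binary blocks of length 2n+1 ending with 1 that contain no two consecutive zeros; and A_n is the set of binary blocks b of length 2n+1 that decompose as b = u ++ 00 ++ a, where for some k with n+2 ≤ k ≤ 2n the suffix a has length k−1, begins and ends with 1, contains no two consecutive zeros, u is an arbitrary binary block of length 2n−k, and the number m of (necessarily isolated) zeros in a satisfies m < k−n−1. -/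
/-- Local rule 168: `f₁₆₈(x₁,x₂,x₃) = (x₁ ∨ x₂) ∧ x₃`. -/
def f168 (x₁ x₂ x₃ : Bool) : Bool := (x₁ || x₂) && x₃

theorem blockMap_append_triple (f : Bool → Bool → Bool → Bool) (l : List Bool) (x y z : Bool) :
    blockMap f (l ++ [x, y, z]) = blockMap f (l ++ [x, y]) ++ [f x y z] := by
  induction l with
  | nil => rfl
  | cons a l ih =>
    rcases l with _ | ⟨b, _ | ⟨c, l⟩⟩
    · rfl
    · rfl
    · simpa [blockMap] using ih

theorem blockMap_reverse (f : Bool → Bool → Bool → Bool) (l : List Bool) :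
    blockMap f l.reverse = (blockMap (fun x y z => f z y x) l).reverse := by
  induction l with
  | nil => rfl
  | cons a l ih =>
    rcases l with _ | ⟨b, _ | ⟨c, l⟩⟩
    · rfl
    · rfl
    · have h := blockMap_append_triple f l.reverse c b a
      simp_all [blockMap]

theorem iterate_blockMap_reverse (f : Bool → Bool → Bool → Bool) (n : ℕ) (l : List Bool) :
    (blockMap f)^[n] l.reverse = ((blockMap fun x y z => f z y x)^[n] l).reverse := by
  induction n generalizing l with
  | zero => rfl
  | succ n ih => rw [Function.iterate_succ_apply, blockMap_reverse, ih, Function.iterate_succ_apply]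

theorem length_iterate_blockMap (f : Bool → Bool → Bool → Bool) (n : ℕ) (l : List Bool) :
    ((blockMap f)^[n] l).length = l.length - 2 * n := by
  induction n generalizing l with
  | zero => rfl
  | succ n ih => rw [Function.iterate_succ_apply, ih, length_blockMap]; omega

theorem tail_blockMap (f : Bool → Bool → Bool → Bool) (l : List Bool) :
    (blockMap f l).tail = blockMap f l.tail := by
  rcases l with _ | ⟨a, _ | ⟨b, _ | ⟨c, l⟩⟩⟩ <;> rfl

theorem tail_iterate_blockMap (f : Bool → Bool → Bool → Bool) (n : ℕ) (l : List Bool) :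
    ((blockMap f)^[n] l).tail = (blockMap f)^[n] l.tail := by
  induction n generalizing l with
  | zero => rfl
  | succ n ih => rw [Function.iterate_succ_apply, ih, tail_blockMap, Function.iterate_succ_apply]

/-- The mirror image of rule 168, acting on blocks read from right to left. -/
def mirrorRule168 : List Bool → List Bool := blockMap fun x y z => f168 z y x

theorem headD_mirrorRule168 {l : List Bool} (hl : 3 ≤ l.length) :
    (mirrorRule168 l).headD false =
      (l.headD false && (l.tail.headD false || l.tail.tail.headD false)) := by
  rcases l with _ | ⟨a, _ | ⟨b, _ | ⟨c, l⟩⟩⟩ <;> simp_all [mirrorRule168, blockMap, f168]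
  grind

/-- A cell survives `n + 1` steps iff it is on and one of its two neighbours survives `n`. -/
theorem headD_iterate_mirrorRule168_succ (n : ℕ) {l : List Bool} (hl : 2 * n + 3 ≤ l.length) :
    (mirrorRule168^[n + 1] l).headD false =
      (l.headD false && ((mirrorRule168^[n] l.tail).headD false ||
        (mirrorRule168^[n] l.tail.tail).headD false)) := by
  induction n generalizing l with
  | zero => exact headD_mirrorRule168 (by omega)
  | succ n ih =>
    have htail (k : ℕ) (m : List Bool) : (mirrorRule168^[k] m).tail = mirrorRule168^[k] m.tail :=
      tail_iterate_blockMap _ _ _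
    have hlen : (mirrorRule168^[n + 1] l).length = l.length - 2 * (n + 1) :=
      length_iterate_blockMap _ _ _
    have hanti (m : List Bool) (hm : 2 * n + 3 ≤ m.length) :
        (mirrorRule168^[n + 1] m).headD false = true →
          (mirrorRule168^[n] m).headD false = true := by
      have hlen' : (mirrorRule168^[n] m).length = m.length - 2 * n :=
        length_iterate_blockMap _ _ _
      rw [Function.iterate_succ_apply', headD_mirrorRule168 (by omega)]
      simp +contextual
    have h₁ := hanti l.tail (by simp; omega)
    have h₂ := hanti l.tail.tail (by simp; omega)
    rw [Function.iterate_succ_apply', headD_mirrorRule168 (by omega), htail, htail,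
      ih (by omega)]
    grind

/-- The number of ones preceding the first occurrence of `00`. -/
def onesBeforeDoubleZero : List Bool → ℕ
  | true :: l => onesBeforeDoubleZero l + 1
  | false :: true :: l => onesBeforeDoubleZero l + 1
  | _ => 0

theorem headD_iterate_mirrorRule168_iff (n : ℕ) {l : List Bool} (hl : 2 * n + 1 ≤ l.length) :
    (mirrorRule168^[n] l).headD false = true ↔
      l.head? = some true ∧ n + 1 ≤ onesBeforeDoubleZero l := by
  induction n generalizing l with
  | zero =>
    rcases l with _ | ⟨_ | _, l⟩ <;> simp [onesBeforeDoubleZero]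
  | succ n ih =>
    rw [headD_iterate_mirrorRule168_succ n (by omega), Bool.and_eq_true, Bool.or_eq_true,
      ih (by simp; omega), ih (by simp; omega)]
    rcases l with _ | ⟨_ | _, _ | ⟨_ | _, _ | ⟨_ | _, l⟩⟩⟩ <;>
      simp [onesBeforeDoubleZero]
    omega

theorem onesBeforeDoubleZero_append {a : List Bool} (u : List Bool)
    (ha : ¬ [false, false] <:+: a) (hlast : a.getLast? ≠ some false) :
    onesBeforeDoubleZero (a ++ [false, false] ++ u) = a.count true := by
  fun_induction onesBeforeDoubleZero a with
  | case1 l ih | case2 l ih =>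
    rcases l with _ | ⟨x, l⟩ <;> simp_all [onesBeforeDoubleZero, List.infix_cons_iff]
  | case3 l h₁ h₂ =>
    rcases l with _ | ⟨_ | _, _ | ⟨_ | _, l⟩⟩ <;>
      simp_all [onesBeforeDoubleZero, List.infix_cons_iff]

theorem onesBeforeDoubleZero_eq_count {a : List Bool} (ha : ¬ [false, false] <:+: a) :
    onesBeforeDoubleZero a = a.count true := by
  fun_induction onesBeforeDoubleZero a with
  | case1 l ih | case2 l ih => simp_all [List.infix_cons_iff]
  | case3 l h₁ h₂ =>
    rcases l with _ | ⟨_ | _, _ | ⟨_ | _, l⟩⟩ <;> simp_all [List.infix_cons_iff]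

theorem count_false_le_count_true_succ {a : List Bool} (ha : ¬ [false, false] <:+: a) :
    a.count false ≤ a.count true + 1 := by
  fun_induction onesBeforeDoubleZero a with
  | case1 l ih =>
    have := ih (by simpa [List.infix_cons_iff] using ha)
    simp
    omega
  | case2 l ih =>
    have := ih (by simpa [List.infix_cons_iff] using ha)
    simpa using this
  | case3 l h₁ h₂ =>
    rcases l with _ | ⟨_ | _, _ | ⟨_ | _, l⟩⟩ <;> simp_all [List.infix_cons_iff]

theorem exists_eq_append_doubleZero {c : List Bool} (hc : [false, false] <:+: c) :
    ∃ a u, c = a ++ [false, false] ++ u ∧ ¬ [false, false] <:+: a ∧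
      a.getLast? ≠ some false := by
  fun_induction onesBeforeDoubleZero c with
  | case1 l ih =>
    obtain ⟨a, u, rfl, h, h'⟩ := ih (by simpa [List.infix_cons_iff] using hc)
    refine ⟨true :: a, u, rfl, by simpa [List.infix_cons_iff] using h, ?_⟩
    rcases a with _ | ⟨x, a⟩ <;> simp_all
  | case2 l ih =>
    obtain ⟨a, u, rfl, h, h'⟩ := ih (by simpa [List.infix_cons_iff] using hc)
    refine ⟨false :: true :: a, u, rfl, by simpa [List.infix_cons_iff] using h, ?_⟩
    rcases a with _ | ⟨x, a⟩ <;> simp_all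
  | case3 l h₁ h₂ =>
    rcases l with _ | ⟨_ | _, _ | ⟨_ | _, l⟩⟩
    case cons.false.cons.false => exact ⟨[], l, by simp⟩
    all_goals simp_all [List.infix_cons_iff]

theorem doubleZero_infix_reverse {l : List Bool} :
    [false, false] <:+: l.reverse ↔ [false, false] <:+: l := by
  rw [← List.reverse_infix]
  simp

theorem iterate_rule168_eq_singleton_iff (n : ℕ) {c : List Bool} (hc : c.length = 2 * n + 1) :
    (blockMap f168)^[n] c.reverse = [true] ↔
      c.head? = some true ∧ n + 1 ≤ onesBeforeDoubleZero c := by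
  rw [← headD_iterate_mirrorRule168_iff n hc.ge, iterate_blockMap_reverse]
  change (mirrorRule168^[n] c).reverse = _ ↔ _
  have hlen : (mirrorRule168^[n] c).length = c.length - 2 * n := length_iterate_blockMap _ _ _
  obtain ⟨x, hx⟩ := List.length_eq_one_iff.1 (hlen.trans (by omega))
  simp [hx]

theorem count_true_add_count_false (l : List Bool) :
    l.count true + l.count false = l.length := by
  simp

/-- For every `n ≥ 0`, a block `b` of length `2n+1` is an `n`-step preimage of `1`
under rule 168 iff `b ∈ Aₙ ∪ Bₙ`, where `Bₙ` consists of the blocks of length `2n+1`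
ending with `1` containing no two consecutive zeros, and `Aₙ` consists of the blocks
`b = u ++ 00 ++ a` where, for some `k` with `n+2 ≤ k ≤ 2n`, the suffix `a` has length
`k-1`, begins and ends with `1`, contains no two consecutive zeros, `u` is arbitrary
of length `2n-k`, and the number `m` of zeros of `a` satisfies `m < k-n-1`. -/
theorem rule168_preimage_characterization (n : ℕ) (b : List Bool)
    (hb : b.length = 2*n+1) :
    (blockMap f168)^[n] b = [true] ↔
      ((∃ k u a, n+2 ≤ k ∧ k ≤ 2*n ∧
          b = u ++ [false, false] ++ a ∧
          u.length = 2*n - k ∧ a.length = k - 1 ∧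
          a.head? = some true ∧ a.getLast? = some true ∧
          ¬ ([false, false] <:+: a) ∧
          a.count false < k - n - 1) ∨
       (b.getLast? = some true ∧ ¬ ([false, false] <:+: b))) := by
  obtain ⟨c, rfl⟩ : ∃ c : List Bool, b = c.reverse := ⟨b.reverse, by simp⟩
  rw [List.length_reverse] at hb
  rw [iterate_rule168_eq_singleton_iff n hb, List.getLast?_reverse, doubleZero_infix_reverse]
  constructor
  · rintro ⟨hhead, hones⟩
    by_cases h00 : [false, false] <:+: c
    · left
      obtain ⟨a, u, rfl, ha, hlast⟩ := exists_eq_append_doubleZero h00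
      rw [onesBeforeDoubleZero_append u ha hlast] at hones
      have hcount := count_true_add_count_false a
      have hne : a ≠ [] := by rintro rfl; simp at hones
      simp only [List.length_append, List.length_cons, List.length_nil] at hb
      refine ⟨a.length + 1, u.reverse, a.reverse, by omega, by omega, by simp, by simp; omega,
        by simp, ?_, ?_, by rwa [doubleZero_infix_reverse], by rw [List.count_reverse]; omega⟩
      · rw [List.head?_reverse]
        rw [List.getLast?_eq_some_getLast hne] at hlast ⊢
        simpa using hlast
      · rw [List.getLast?_reverse]
        rwa [List.append_assoc, List.head?_append_of_ne_nil _ hne] at hhead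
    · exact Or.inr ⟨hhead, h00⟩
  · rintro (⟨k, u, a, hk, hk', hc, hu, ha, hhead, hlast, h00, hcount⟩ | ⟨hhead, h00⟩)
    · have hc' : c = a.reverse ++ [false, false] ++ u.reverse := by
        rw [← List.reverse_inj, hc]
        simp
      have hsum := count_true_add_count_false a
      rw [hc', onesBeforeDoubleZero_append _ (by rwa [doubleZero_infix_reverse]) (by simp [hhead]),
        List.count_reverse]
      exact ⟨by simp [hlast], by omega⟩
    · refine ⟨hhead, ?_⟩
      rw [onesBeforeDoubleZero_eq_count h00]
      obtain ⟨l, rfl⟩ : ∃ l, c = true :: l := by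
        rcases c with _ | ⟨x, l⟩ <;> simp_all
      have hl := count_false_le_count_true_succ (a := l) (by simpa [List.infix_cons_iff] using h00)
      have hsum := count_true_add_count_false l
      simp at hb ⊢
      omega
end

section
/- For every n ≥ 0, the set A_n (binary blocks b of length 2n+1 decomposing as b = u ++ 00 ++ a, where for some k with n+2 ≤ k ≤ 2n the suffix a has length k−1, begins and ends with 1, contains no two consecutive zeros, u is an arbitrary binary block of length 2n−k, and the number m of zeros in a satisfies m < k−n−1) satisfies the polynomial identity Σ_{b ∈ A_n} p^{#₁(b)} q^{#₀(b)} = Σ_{j=0}^{n−2} Σ_{m=0}^{j} (p+q)^{n−j−2} C(n+j−m, m) q^{m+2} p^{n+j−m+1}. -/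
/-- The blocks with `r + 1` ones and `m` zeros that begin and end with `1` and contain no two
consecutive zeros. -/
def isolatedZeroBlocks : ℕ → ℕ → Finset (List Bool)
  | 0, 0 => {[true]}
  | 0, _ + 1 => ∅
  | r + 1, 0 => (isolatedZeroBlocks r 0).image (true :: ·)
  | r + 1, m + 1 => (isolatedZeroBlocks r (m + 1)).image (true :: ·) ∪
      (isolatedZeroBlocks r m).image (true :: false :: ·)

theorem isolatedZeroBlocks_sound (r m : ℕ) : ∀ a ∈ isolatedZeroBlocks r m,
    a.head? = some true ∧ a.getLast? = some true ∧ ¬ ([false, false] <:+: a) ∧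
      a.count true = r + 1 ∧ a.count false = m := by
  induction r, m using isolatedZeroBlocks.induct with
  | case1 => simp [isolatedZeroBlocks, List.infix_cons_iff]
  | case2 => simp [isolatedZeroBlocks]
  | case3 r ih =>
    intro a ha
    simp only [isolatedZeroBlocks, Finset.mem_image] at ha
    obtain ⟨b, hb, rfl⟩ := ha
    obtain ⟨h1, h2, h3, h4, h5⟩ := ih b hb
    simp [List.getLast?_cons, h2, List.infix_cons_iff, h3, h4, h5]
  | case4 r m ih1 ih2 =>
    intro a ha
    simp only [isolatedZeroBlocks, Finset.mem_union, Finset.mem_image] at ha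
    obtain ⟨b, hb, rfl⟩ | ⟨b, hb, rfl⟩ := ha
    · obtain ⟨h1, h2, h3, h4, h5⟩ := ih1 b hb
      simp [List.getLast?_cons, h2, List.infix_cons_iff, h3, h4, h5]
    · obtain ⟨h1, h2, h3, h4, h5⟩ := ih2 b hb
      obtain ⟨t, rfl⟩ : ∃ t, b = true :: t := by
        exact ⟨_, List.eq_cons_of_mem_head? h1⟩
      simp_all [List.getLast?_cons, List.infix_cons_iff]

theorem isolatedZeroBlocks_complete : ∀ (a : List Bool) (r m : ℕ), a.head? = some true →
    a.getLast? = some true → ¬ ([false, false] <:+: a) → a.count true = r + 1 →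
    a.count false = m → a ∈ isolatedZeroBlocks r m
  | [], _, _ => by simp
  | false :: _, _, _ => by simp
  | [true], r, m => by
    intro _ _ _ h4 h5
    obtain rfl : r = 0 := by simpa using h4.symm
    obtain rfl : m = 0 := by simpa using h5.symm
    simp [isolatedZeroBlocks]
  | true :: true :: t, r, m => by
    intro _ h2 h3 h4 h5
    obtain ⟨r, rfl⟩ : ∃ s, r = s + 1 := ⟨t.count true, by simp at h4; omega⟩
    have ih := isolatedZeroBlocks_complete (true :: t) r m rfl (by simpa using h2)
      (fun h => h3 (List.infix_cons h)) (by simpa using h4) (by simpa using h5)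
    cases m <;> simp [isolatedZeroBlocks, ih]
  | [true, false], _, _ => by simp
  | true :: false :: false :: t, _, _ => by simp [List.infix_cons_iff]
  | true :: false :: true :: t, r, m => by
    intro _ h2 h3 h4 h5
    obtain ⟨r, rfl⟩ : ∃ s, r = s + 1 := ⟨t.count true, by simp at h4; omega⟩
    obtain ⟨m, rfl⟩ : ∃ s, m = s + 1 := ⟨t.count false, by simp at h5; omega⟩
    have ih := isolatedZeroBlocks_complete (true :: t) r m rfl (by simpa using h2)
      (fun h => h3 (List.infix_cons (List.infix_cons h))) (by simpa using h4) (by simpa using h5)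
    simp [isolatedZeroBlocks, ih]

theorem mem_isolatedZeroBlocks {a : List Bool} {r m : ℕ} : a ∈ isolatedZeroBlocks r m ↔
    a.head? = some true ∧ a.getLast? = some true ∧ ¬ ([false, false] <:+: a) ∧
      a.count true = r + 1 ∧ a.count false = m :=
  ⟨isolatedZeroBlocks_sound r m a,
    fun ⟨h1, h2, h3, h4, h5⟩ => isolatedZeroBlocks_complete a r m h1 h2 h3 h4 h5⟩

theorem card_isolatedZeroBlocks (r m : ℕ) : (isolatedZeroBlocks r m).card = r.choose m := by
  induction r, m using isolatedZeroBlocks.induct with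
  | case1 => simp [isolatedZeroBlocks]
  | case2 => simp [isolatedZeroBlocks]
  | case3 r ih =>
    rw [isolatedZeroBlocks, Finset.card_image_of_injective _ (List.cons_injective), ih]
    simp
  | case4 r m ih1 ih2 =>
    rw [isolatedZeroBlocks, Finset.card_union_of_disjoint,
      Finset.card_image_of_injective _ (List.cons_injective),
      Finset.card_image_of_injective (f := (true :: false :: ·)) _
        (List.cons_injective.comp List.cons_injective),
      ih1, ih2, Nat.choose_succ_succ, add_comm]
    rw [Finset.disjoint_left]
    simp only [Finset.mem_image, not_exists, not_and]
    rintro _ ⟨b, hb, rfl⟩ c _ h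
    have := (isolatedZeroBlocks_sound _ _ b hb).1
    simp only [List.cons.injEq, true_and] at h
    simp [← h] at this

/-- The last occurrence of `00` in a block is unique. -/
theorem append_zero_zero_inj {a a' : List Bool} (ha : a.head? = some true)
    (ha' : a'.head? = some true) (hz : ¬ ([false, false] <:+: a))
    (hz' : ¬ ([false, false] <:+: a')) : ∀ u u' : List Bool,
    u ++ [false, false] ++ a = u' ++ [false, false] ++ a' → u = u' ∧ a = a'
  | [], [] => by simp
  | [], [_] => by
    intro h
    simp only [List.nil_append, List.cons_append, List.cons.injEq, true_and] at h
    simp [h.2] at ha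
  | [], _ :: _ :: t => by
    intro h
    simp only [List.nil_append, List.cons_append, List.cons.injEq] at h
    exact absurd ⟨t, a', h.2.2.symm⟩ hz
  | [_], [] => by
    intro h
    simp only [List.nil_append, List.cons_append, List.cons.injEq, true_and] at h
    simp [← h.2] at ha'
  | _ :: _ :: t, [] => by
    intro h
    simp only [List.nil_append, List.cons_append, List.cons.injEq] at h
    exact absurd ⟨t, a, h.2.2⟩ hz'
  | x :: u, y :: u' => by
    intro h
    simp only [List.cons_append, List.cons.injEq] at h
    obtain ⟨rfl, h⟩ := h
    obtain ⟨rfl, rfl⟩ := append_zero_zero_inj ha ha' hz hz' u u' h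
    simp

/-- All binary blocks of length `L`. -/
def binaryWords (L : ℕ) : Finset (List Bool) :=
  Finset.univ.image (List.ofFn : (Fin L → Bool) → List Bool)

theorem mem_binaryWords {L : ℕ} {u : List Bool} : u ∈ binaryWords L ↔ u.length = L := by
  simp only [binaryWords, Finset.mem_image, Finset.mem_univ, true_and]
  constructor
  · rintro ⟨f, rfl⟩
    simp
  · rintro rfl
    exact ⟨u.get, List.ofFn_get u⟩

theorem weight_eq_prod_map {R : Type*} [CommSemiring R] (p q : R) (l : List Bool) :
    p ^ l.count true * q ^ l.count false = (l.map fun x => if x then p else q).prod := by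
  induction l with
  | nil => simp
  | cons x l ih => cases x <;> simp [← ih] <;> ring

theorem sum_binaryWords {R : Type*} [CommSemiring R] (p q : R) (L : ℕ) :
    ∑ u ∈ binaryWords L, p ^ u.count true * q ^ u.count false = (p + q) ^ L := by
  rw [binaryWords, Finset.sum_image fun _ _ _ _ h => List.ofFn_injective h]
  have h := Fintype.sum_pow (fun x : Bool => if x then p else q) L
  simp only [Fintype.sum_bool, if_true, Bool.false_eq_true, if_false] at h
  rw [h]
  refine Finset.sum_congr rfl fun f _ => ?_
  rw [weight_eq_prod_map, List.map_ofFn, List.prod_ofFn]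
  rfl

theorem sum_words_zero_zero_blocks {R : Type*} [CommSemiring R] (p q : R) (L r m : ℕ) :
    ∑ x ∈ binaryWords L ×ˢ isolatedZeroBlocks r m,
      p ^ (x.1 ++ [false, false] ++ x.2).count true *
        q ^ (x.1 ++ [false, false] ++ x.2).count false =
    (p + q) ^ L * (r.choose m : R) * q ^ (m + 2) * p ^ (r + 1) := by
  rw [Finset.sum_product, ← sum_binaryWords, ← card_isolatedZeroBlocks, Finset.sum_mul,
    Finset.sum_mul, Finset.sum_mul]
  refine Finset.sum_congr rfl fun u _ => ?_
  rw [Finset.sum_congr rfl (g := fun _ => p ^ u.count true * q ^ u.count false *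
    q ^ (m + 2) * p ^ (r + 1)), Finset.sum_const, nsmul_eq_mul]
  · ring
  · intro a ha
    obtain ⟨-, -, -, h4, h5⟩ := mem_isolatedZeroBlocks.1 ha
    simp only [List.count_append, h4, h5, List.count_cons, List.count_nil]
    simp only [beq_self_eq_true, if_true, beq_iff_eq, Bool.false_eq_true, if_false]
    ring


open Classical in
/-- For every `n ≥ 0`, the density polynomial of the set `Aₙ` of blocks
`b = u ++ 00 ++ a` of length `2n+1` (where for some `k` with `n+2 ≤ k ≤ 2n` the
suffix `a` has length `k-1`, begins and ends with `1`, contains no two consecutive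
zeros, `u` is arbitrary of length `2n-k`, and the number `m` of zeros of `a`
satisfies `m < k-n-1`) equals
`Σ_{j=0}^{n-2} Σ_{m=0}^{j} (p+q)^{n-j-2} C(n+j-m, m) q^{m+2} p^{n+j-m+1}`. -/
theorem rule168_An_density (n : ℕ) (p q : ℝ) :
    ∑ b ∈ Finset.univ.filter (fun b : Fin (2*n+1) → Bool =>
        ∃ k u a, n+2 ≤ k ∧ k ≤ 2*n ∧
          List.ofFn b = u ++ [false, false] ++ a ∧
          u.length = 2*n - k ∧ a.length = k - 1 ∧
          a.head? = some true ∧ a.getLast? = some true ∧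
          ¬ ([false, false] <:+: a) ∧
          a.count false < k - n - 1),
      p ^ (List.ofFn b).count true * q ^ (List.ofFn b).count false
    = ∑ j ∈ Finset.range (n-1), ∑ m ∈ Finset.range (j+1),
        (p + q) ^ (n-j-2) * (Nat.choose (n+j-m) m : ℝ) * q ^ (m+2) * p ^ (n+j-m+1) := by
  have hrhs : ∀ j ∈ Finset.range (n-1), ∀ m ∈ Finset.range (j+1),
      (p + q) ^ (n-j-2) * (Nat.choose (n+j-m) m : ℝ) * q ^ (m+2) * p ^ (n+j-m+1) =
      ∑ x ∈ binaryWords (n-j-2) ×ˢ isolatedZeroBlocks (n+j-m) m,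
        p ^ (x.1 ++ [false, false] ++ x.2).count true *
          q ^ (x.1 ++ [false, false] ++ x.2).count false :=
    fun j _ m _ => (sum_words_zero_zero_blocks p q _ _ _).symm
  rw [Finset.sum_congr rfl fun j hj => Finset.sum_congr rfl (hrhs j hj)]
  simp only [Finset.sum_sigma']
  rw [← Finset.sum_image (s := Finset.univ.filter _) (g := List.ofFn)
    (f := fun l : List Bool => p ^ l.count true * q ^ l.count false)
    fun _ _ _ _ h => List.ofFn_injective h]
  symm
  refine Finset.sum_nbij (fun x => x.2.2.1 ++ [false, false] ++ x.2.2.2) ?_ ?_ ?_ fun _ _ => rfl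
  · rintro ⟨j, m, u, a⟩ hx
    simp only [Finset.mem_sigma, Finset.mem_range, Finset.mem_product, mem_binaryWords,
      mem_isolatedZeroBlocks] at hx
    obtain ⟨hj, hm, hu, h1, h2, h3, h4, h5⟩ := hx
    have hlen := List.count_true_add_count_false a
    have hl : (u ++ [false, false] ++ a).length = 2 * n + 1 := by simp; omega
    obtain ⟨f, hf⟩ := Finset.mem_image.1 (mem_binaryWords.2 hl)
    refine Finset.mem_image.2 ⟨f, ?_, hf.2⟩
    simp only [Finset.mem_filter, Finset.mem_univ, true_and]
    exact ⟨n + 2 + j, u, a, by omega, by omega, hf.2, by omega, by omega, h1, h2, h3, by omega⟩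
  · rintro ⟨j, m, u, a⟩ hx ⟨j', m', u', a'⟩ hx' h
    simp only [Finset.mem_coe, Finset.mem_sigma, Finset.mem_range, Finset.mem_product,
      mem_binaryWords, mem_isolatedZeroBlocks] at hx hx'
    obtain ⟨hj, hm, hu, h1, h2, h3, h4, h5⟩ := hx
    obtain ⟨hj', hm', hu', h1', h2', h3', h4', h5'⟩ := hx'
    obtain ⟨rfl, rfl⟩ := append_zero_zero_inj h1 h1' h3 h3' u u' h
    obtain rfl : m = m' := by omega
    obtain rfl : j = j' := by omega
    rfl
  · intro l hl
    simp only [Finset.coe_image, Set.mem_image, Finset.mem_coe, Finset.mem_filter,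
      Finset.mem_univ, true_and] at hl
    obtain ⟨f, ⟨k, u, a, hk, hk', hf, hu, ha, h1, h2, h3, h4⟩, rfl⟩ := hl
    have hlen := List.count_true_add_count_false a
    refine ⟨⟨k - n - 2, a.count false, u, a⟩, ?_, hf.symm⟩
    simp only [Finset.mem_coe, Finset.mem_sigma, Finset.mem_range, Finset.mem_product,
      mem_binaryWords, mem_isolatedZeroBlocks]
    exact ⟨by omega, by omega, by omega, h1, h2, h3, by omega, trivial⟩
end

section
/- For every n ≥ 0, the following identity of polynomials in two variables p, q holds: Σ_{j=0}^{n−2} Σ_{m=0}^{j} (p+q)^{n−j−2} C(n+j−m, m) q^{m+2} p^{n+j−m+1} + Σ_{m=0}^{n} C(2n+1−m, m) q^m p^{2n+1−m} = p^{n+1}(p+2q)^{n}. -/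
/-- The coefficient of `x ^ j` in `(p * (1 + q * x)) ^ n / (1 - p * x * (1 + q * x))`. -/
def truncatedSum (p q : ℝ) (n j : ℕ) : ℝ :=
  ∑ l ∈ Finset.range (j + 1), (Nat.choose (n + l) (j - l) : ℝ) * q ^ (j - l) * p ^ (n + l)

theorem truncatedSum_eq_sum_reflect (p q : ℝ) (n j : ℕ) :
    truncatedSum p q n j = ∑ m ∈ Finset.range (j + 1),
      (Nat.choose (n + j - m) m : ℝ) * q ^ m * p ^ (n + j - m) := by
  rw [truncatedSum, ← Finset.sum_range_reflect]
  refine Finset.sum_congr rfl fun m hm => ?_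
  have hm' : m ≤ j := Nat.lt_succ_iff.mp (Finset.mem_range.mp hm)
  rw [show j + 1 - 1 - m = j - m by omega, show j - (j - m) = m by omega,
    show n + (j - m) = n + j - m by omega]

theorem truncatedSum_succ_right (p q : ℝ) (n j : ℕ) :
    truncatedSum p q n (j + 1) =
      (Nat.choose n (j + 1) : ℝ) * q ^ (j + 1) * p ^ n + truncatedSum p q (n + 1) j := by
  rw [truncatedSum, Finset.sum_range_succ', truncatedSum, add_comm]
  congr 1
  refine Finset.sum_congr rfl fun l _ => ?_
  rw [show j + 1 - (l + 1) = j - l by omega, show n + (l + 1) = n + 1 + l by omega]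

theorem truncatedSum_succ_succ (p q : ℝ) (n j : ℕ) :
    truncatedSum p q (n + 1) (j + 1) =
      p * truncatedSum p q n (j + 1) + p * q * truncatedSum p q n j := by
  simp only [truncatedSum]
  rw [Finset.sum_range_succ, Finset.sum_range_succ _ (j + 1), mul_add, Finset.mul_sum,
    Finset.mul_sum, add_right_comm (Finset.sum _ _), ← Finset.sum_add_distrib]
  congr 1
  · refine Finset.sum_congr rfl fun l hl => ?_
    have hl' : l ≤ j := Nat.lt_succ_iff.mp (Finset.mem_range.mp hl)
    rw [show j + 1 - l = j - l + 1 by omega, show n + 1 + l = n + l + 1 by omega,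
      Nat.choose_succ_succ]
    push_cast
    ring
  · simp
    ring

theorem sum_truncatedSum_add (p q : ℝ) (n N : ℕ) :
    (∑ j ∈ Finset.range N, (p + q) ^ (N - 1 - j) * (q ^ 2 * p * truncatedSum p q n j))
      + truncatedSum p q (n + 1) (N + 1) =
    p ^ (n + 1) * ∑ k ∈ Finset.range (N + 2), q ^ k * (p + q) ^ (N + 1 - k) * n.choose k := by
  induction N with
  | zero =>
    simp [truncatedSum, Finset.sum_range_succ]
    ring
  | succ N ih =>
    have hW : ∑ j ∈ Finset.range N,
          (p + q) ^ (N + 1 - 1 - j) * (q ^ 2 * p * truncatedSum p q n j) =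
        (p + q) * ∑ j ∈ Finset.range N,
          (p + q) ^ (N - 1 - j) * (q ^ 2 * p * truncatedSum p q n j) := by
      rw [Finset.mul_sum]
      refine Finset.sum_congr rfl fun j hj => ?_
      have hj' := Finset.mem_range.mp hj
      rw [show N + 1 - 1 - j = N - 1 - j + 1 by omega]
      ring
    have hE : ∑ k ∈ Finset.range (N + 2), q ^ k * (p + q) ^ (N + 1 + 1 - k) * n.choose k =
        (p + q) * ∑ k ∈ Finset.range (N + 2), q ^ k * (p + q) ^ (N + 1 - k) * n.choose k := by
      rw [Finset.mul_sum]
      refine Finset.sum_congr rfl fun k hk => ?_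
      have hk' := Finset.mem_range.mp hk
      rw [show N + 1 + 1 - k = N + 1 - k + 1 by omega]
      ring
    rw [Finset.sum_range_succ, hW, Finset.sum_range_succ _ (N + 2), hE]
    have h₁ := truncatedSum_succ_succ p q n N
    have h₂ := truncatedSum_succ_succ p q n (N + 1)
    have h₃ := truncatedSum_succ_right p q n (N + 1)
    simp only [show N + 1 - 1 - N = 0 by omega, show N + 1 + 1 - (N + 2) = 0 by omega, pow_zero]
    linear_combination (p + q) * ih + h₂ + p * h₃ - q * h₁

/-- For every `n ≥ 0` and all `p q`:
`Σ_{j=0}^{n-2} Σ_{m=0}^{j} (p+q)^{n-j-2} C(n+j-m,m) q^{m+2} p^{n+j-m+1}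
  + Σ_{m=0}^{n} C(2n+1-m,m) qᵐ p^{2n+1-m} = p^{n+1}(p+2q)ⁿ`
(the outer sum being empty for `n ≤ 1`). -/
theorem rule168_density_polynomial_identity (n : ℕ) (p q : ℝ) :
    (∑ j ∈ Finset.range (n-1), ∑ m ∈ Finset.range (j+1),
        (p + q) ^ (n-j-2) * (Nat.choose (n+j-m) m : ℝ) * q ^ (m+2) * p ^ (n+j-m+1))
    + (∑ m ∈ Finset.range (n+1),
        (Nat.choose (2*n+1-m) m : ℝ) * q ^ m * p ^ (2*n+1-m))
    = p ^ (n+1) * (p + 2*q) ^ n := by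
  obtain _ | N := n
  · simp
  have h := sum_truncatedSum_add p q (N + 1) N
  rw [← add_pow, show q + (p + q) = p + 2 * q by ring] at h
  rw [← h, truncatedSum_eq_sum_reflect,
    show N + 1 + 1 + (N + 1) = 2 * (N + 1) + 1 by omega]
  congr 1
  refine Finset.sum_congr rfl fun j _ => ?_
  rw [truncatedSum_eq_sum_reflect, Finset.mul_sum, Finset.mul_sum]
  refine Finset.sum_congr rfl fun m _ => ?_
  rw [show N + 1 - j - 2 = N - 1 - j by omega]
  ring
end

section
/- For elementary cellular automaton rule 136 and every n ≥ 0, a binary block b₁b₂…b_{2n+1} is an n-step preimage of 1 if and only if its last n+1 symbols all equal 1; consequently Σ_{b ∈ 𝐟₁₃₆⁻ⁿ(1)} p^{#₁(b)} q^{#₀(b)} = p^{n+1}(p+q)^{n}, and the density of ones after n iterations of rule 136 starting from a Bernoulli distribution with density c₀ is c_n = c₀^{n+1}. -/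
/-- Local rule 136: `f₁₃₆(x₁,x₂,x₃) = x₂·x₃`. -/
def f136 (_x₁ x₂ x₃ : Bool) : Bool := x₂ && x₃

theorem blockMap_ofFn (f : Bool → Bool → Bool → Bool) :
    ∀ (m : ℕ) (b : Fin (m + 2) → Bool),
      blockMap f (List.ofFn b) =
        List.ofFn fun i : Fin m => f (b (i.castSucc.castSucc)) (b i.succ.castSucc) (b i.succ.succ)
  | 0, b => by simp [List.ofFn_succ, blockMap]
  | m + 1, b => by
    have ih := blockMap_ofFn f m (fun i => b i.succ)
    rw [List.ofFn_succ (n := m), List.ofFn_succ (n := m + 2), List.ofFn_succ (n := m + 1),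
      List.ofFn_succ (n := m), blockMap]
    rw [List.ofFn_succ (n := m + 1), List.ofFn_succ (n := m)] at ih
    rw [ih]
    rfl

theorem iterate_blockMap_f136_eq_singleton_true_iff (n : ℕ) (b : Fin (2 * n + 1) → Bool) :
    (blockMap f136)^[n] (List.ofFn b) = [true] ↔
      ∀ i : Fin (2 * n + 1), n ≤ i.val → b i = true := by
  induction n with
  | zero => simp [List.ofFn_succ, Fin.forall_fin_succ]
  | succ n ih =>
    change Fin (2 * n + 1 + 2) → Bool at b
    have hb := blockMap_ofFn f136 (2 * n + 1) b
    change (blockMap f136)^[n] (blockMap f136 (List.ofFn b)) = [true] ↔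
      ∀ i : Fin (2 * n + 1 + 2), n + 1 ≤ i.val → b i = true
    rw [hb, ih]
    simp only [f136, Bool.and_eq_true]
    constructor
    · intro h i hi
      by_cases hlt : i.val < 2 * n + 2
      · convert (h ⟨i.val - 1, by omega⟩ (by simp only; omega)).1 using 2
        ext
        simp only [Fin.val_castSucc, Fin.val_succ]
        omega
      · convert (h ⟨2 * n, by omega⟩ (by simp only; omega)).2 using 2
        ext
        simp only [Fin.val_succ]
        omega
    · intro h i hi
      exact ⟨h _ (by simpa using hi), h _ (by simp only [Fin.val_succ]; omega)⟩

theorem pow_count_true_mul_pow_count_false {R : Type*} [CommMonoid R] (p q : R) (l : List Bool) :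
    p ^ l.count true * q ^ l.count false = (l.map fun x => if x then p else q).prod := by
  induction l with
  | nil => simp
  | cons a l ih =>
    cases a <;> simp [pow_succ, ← ih, mul_left_comm, mul_comm, mul_assoc]

theorem sum_iterate_blockMap_f136_preimages {R : Type*} [CommSemiring R] (n : ℕ) (p q : R) :
    ∑ b ∈ Finset.univ.filter
        (fun b : Fin (2 * n + 1) → Bool => (blockMap f136)^[n] (List.ofFn b) = [true]),
      p ^ (List.ofFn b).count true * q ^ (List.ofFn b).count false
    = p ^ (n + 1) * (p + q) ^ n := by
  have hset : Finset.univ.filter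
      (fun b : Fin (2 * n + 1) → Bool => (blockMap f136)^[n] (List.ofFn b) = [true]) =
      Fintype.piFinset fun i : Fin (2 * n + 1) =>
        if n ≤ i.val then {true} else (Finset.univ : Finset Bool) := by
    ext b
    simp only [Finset.mem_filter, Finset.mem_univ, true_and,
      iterate_blockMap_f136_eq_singleton_true_iff, Fintype.mem_piFinset]
    refine forall_congr' fun i => ?_
    split_ifs with h <;> simp [h]
  simp only [hset, pow_count_true_mul_pow_count_false, List.map_ofFn, List.prod_ofFn,
    Function.comp_apply]
  rw [← Finset.prod_univ_sum _ fun (_ : Fin (2 * n + 1)) (x : Bool) => if x then p else q]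
  have hfactor : ∀ i : Fin (2 * n + 1),
      (∑ x ∈ if n ≤ i.val then {true} else (Finset.univ : Finset Bool), if x then p else q) =
        if n ≤ i.val then p else p + q := by
    intro i
    split_ifs <;> simp
  rw [Finset.prod_congr rfl fun i _ => hfactor i,
    Fin.prod_univ_eq_prod_range (fun i => if n ≤ i then p else p + q),
    show 2 * n + 1 = n + (n + 1) by ring, Finset.prod_range_add,
    Finset.prod_congr rfl fun i hi => if_neg (not_le.2 (Finset.mem_range.1 hi))]
  simp [mul_comm]

/-- For rule 136 and every `n ≥ 0`, a block `b₁…b_{2n+1}` is an `n`-step preimage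
of `1` iff its last `n+1` symbols all equal `1`; consequently
`Σ_{b ∈ 𝐟₁₃₆⁻ⁿ(1)} p^{#₁(b)} q^{#₀(b)} = p^{n+1}(p+q)ⁿ`, and the density of ones
after `n` iterations starting from a Bernoulli distribution with density `c₀`
is `c_n = c₀^{n+1}`. -/
theorem rule136_density (n : ℕ) :
    (∀ b : Fin (2*n+1) → Bool,
      (blockMap f136)^[n] (List.ofFn b) = [true] ↔
        ∀ i : Fin (2*n+1), n ≤ i.val → b i = true) ∧
    (∀ p q : ℝ,
      ∑ b ∈ Finset.univ.filter
          (fun b : Fin (2*n+1) → Bool => (blockMap f136)^[n] (List.ofFn b) = [true]),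
        p ^ (List.ofFn b).count true * q ^ (List.ofFn b).count false
      = p ^ (n+1) * (p + q) ^ n) ∧
    (∀ c₀ : ℝ,
      ∑ b ∈ Finset.univ.filter
          (fun b : Fin (2*n+1) → Bool => (blockMap f136)^[n] (List.ofFn b) = [true]),
        c₀ ^ (List.ofFn b).count true * (1 - c₀) ^ (List.ofFn b).count false
      = c₀ ^ (n+1)) := by
  refine ⟨iterate_blockMap_f136_eq_singleton_true_iff n,
    sum_iterate_blockMap_f136_preimages n, fun c₀ => ?_⟩
  rw [sum_iterate_blockMap_f136_preimages n c₀ (1 - c₀), add_sub_cancel, one_pow, mul_one]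
end

section
/- For elementary cellular automaton rule 132 and every n ≥ 0 and every c₀ ∈ [0,1], the density of ones after n iterations starting from a Bernoulli distribution with density c₀ satisfies Σ_{b ∈ 𝐟₁₃₂⁻ⁿ(1)} c₀^{#₁(b)} (1−c₀)^{#₀(b)} = (1−c₀)²c₀ + (1−c₀)c₀³/(1+c₀) + (2c₀/(1+c₀))·c₀^{2n+1}. -/
/-- Local rule 132: `f₁₃₂(1,1,1) = f₁₃₂(0,1,0) = 1`, and `0` otherwise. -/
def f132 (x₁ x₂ x₃ : Bool) : Bool := (x₁ && x₂ && x₃) || (!x₁ && x₂ && !x₃)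

theorem blockMap_cons_concat (f : Bool → Bool → Bool → Bool) (x a b c d y : Bool)
    (l r : List Bool) (hl : l = a :: b :: r) (hr : ∃ s, l = s ++ [c, d]) :
    blockMap f (x :: l ++ [y]) = f x a b :: blockMap f l ++ [f c d y] := by
  obtain ⟨s, hs⟩ := hr
  have concat : ∀ s : List Bool,
      blockMap f (s ++ [c, d] ++ [y]) = blockMap f (s ++ [c, d]) ++ [f c d y] := by
    intro s
    induction s with
    | nil => simp [blockMap]
    | cons p s ih =>
      rcases s with _ | ⟨q, _ | ⟨r, s⟩⟩ <;> simp_all [blockMap]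
  have := concat s
  rw [← hs] at this
  subst hl
  simpa [blockMap] using this

theorem forall_blockMap_f132_of_forall (l : List Bool) (h : ∀ a ∈ l, a = true) :
    ∀ a ∈ blockMap f132 l, a = true := by
  fun_induction blockMap f132 l with
  | case1 a b c rest ih => simp_all [f132]
  | case2 l _ => simp

theorem forall_or_eq_of_forall_blockMap_f132 (l : List Bool) (hl : 3 ≤ l.length)
    (h : ∀ a ∈ blockMap f132 l, a = true) :
    (∀ a ∈ l, a = true) ∨ l = [false, true, false] := by
  fun_induction blockMap f132 l with
  | case1 a b c rest ih =>
    rcases rest with _ | ⟨d, rest⟩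
    · revert h; revert a b c; simp [blockMap, f132]
    · have ih' := ih (by simp) (fun x hx => h x (by simp [hx]))
      have h0 := h _ List.mem_cons_self
      rcases ih' with ih' | ih'
      · left
        simp_all [f132]
      · simp at ih'
        obtain ⟨rfl, rfl, rfl, rfl⟩ := ih'
        simp [f132] at h0
  | case2 l h' =>
    rcases l with _ | ⟨a, _ | ⟨b, _ | ⟨c, r⟩⟩⟩
    · simp at hl
    · simp at hl
    · simp at hl
    · exact absurd rfl (h' a b c r)

theorem iterate_f132_of_forall (n : ℕ) (l : List Bool) (hl : l.length = 2 * n + 1)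
    (h : ∀ a ∈ l, a = true) : (blockMap f132)^[n] l = [true] := by
  induction n generalizing l with
  | zero =>
    obtain ⟨a, rfl⟩ := List.length_eq_one_iff.mp hl
    simpa using h
  | succ n ih =>
    rw [Function.iterate_succ_apply]
    exact ih _ (by rw [length_blockMap]; omega) (forall_blockMap_f132_of_forall l h)

theorem iterate_f132_cons_concat (n : ℕ) (l : List Bool) (hl : l.length = 2 * n + 1)
    (x y : Bool) :
    (blockMap f132)^[n + 1] (x :: l ++ [y]) = [true] ↔
      (blockMap f132)^[n] l = [true] ∧ ((∀ a ∈ l, a = true) → x = y) := by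
  induction n generalizing l x y with
  | zero =>
    obtain ⟨a, rfl⟩ := List.length_eq_one_iff.mp hl
    revert x a y
    simp [blockMap, f132]
  | succ n ih =>
    obtain ⟨a, b, r, har⟩ : ∃ a b r, l = a :: b :: r := by
      rcases l with _ | ⟨a, _ | ⟨b, r⟩⟩
      · simp at hl
      · simp at hl
      · exact ⟨a, b, r, rfl⟩
    obtain ⟨s, c, d, hcd⟩ : ∃ s c d, l = s ++ [c, d] := by
      rcases l.eq_nil_or_concat with rfl | ⟨s, d, rfl⟩
      · simp at hl
      rcases s.eq_nil_or_concat with rfl | ⟨s, c, rfl⟩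
      · simp at hl
      · exact ⟨s, c, d, by simp⟩
    rw [Function.iterate_succ_apply, blockMap_cons_concat f132 x a b c d y l r har ⟨s, hcd⟩,
      ih _ (by rw [length_blockMap]; omega), ← Function.iterate_succ_apply]
    refine and_congr_right fun _ => ?_
    by_cases hall : ∀ e ∈ l, e = true
    · have ha : a = true := hall a (by simp [har])
      have hb : b = true := hall b (by simp [har])
      have hc : c = true := hall c (by simp [hcd])
      have hd : d = true := hall d (by simp [hcd])
      have hF := forall_blockMap_f132_of_forall l hall
      rw [imp_iff_right hF, imp_iff_right hall]
      simp [ha, hb, hc, hd, f132]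
    · refine iff_of_true (fun hF => ?_) (fun h => absurd h hall)
      rcases forall_or_eq_of_forall_blockMap_f132 l (by omega) hF with h | h
      · exact absurd h hall
      · have hd : [c, d] = [true, false] := by
          rw [hcd] at h
          exact (List.append_inj' (h.trans (show _ = [false] ++ [true, false] from rfl)) rfl).2
        rw [h] at har
        simp at har hd
        obtain ⟨rfl, rfl, rfl⟩ := har
        obtain ⟨rfl, rfl⟩ := hd
        simp [f132]

theorem sum_ofFn_add_two (m : ℕ) (g : List Bool → ℝ) :
    ∑ b : Fin (m + 2) → Bool, g (List.ofFn b) =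
      ∑ b : Fin m → Bool, ∑ x, ∑ y, g (x :: List.ofFn b ++ [y]) := by
  rw [← (Fin.consEquiv fun _ : Fin (m + 2) => Bool).sum_comp, Fintype.sum_prod_type,
    Finset.sum_comm]
  rw [← (Fin.snocEquiv fun _ : Fin (m + 1) => Bool).sum_comp, Fintype.sum_prod_type,
    Finset.sum_comm]
  refine Finset.sum_congr rfl fun b _ => ?_
  rw [Finset.sum_comm]
  refine Finset.sum_congr rfl fun x _ => Finset.sum_congr rfl fun y _ => ?_
  congr 1
  simp only [Fin.consEquiv, Fin.snocEquiv, Equiv.coe_fn_mk, List.ofFn_cons, List.cons_append]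
  simp only [List.ofFn_succ', List.concat_eq_append, Fin.snoc_castSucc, Fin.snoc_last]

theorem sum_ends_f132 (n : ℕ) (c : ℝ) (l : List Bool) (hl : l.length = 2 * n + 1) :
    ∑ x, ∑ y, (if (blockMap f132)^[n + 1] (x :: l ++ [y]) = [true] then
        c ^ (x :: l ++ [y]).count true * (1 - c) ^ (x :: l ++ [y]).count false else 0) =
      (if (blockMap f132)^[n] l = [true] then
        c ^ l.count true * (1 - c) ^ l.count false else 0) -
      if ∀ a ∈ l, a = true then 2 * c * (1 - c) * c ^ (2 * n + 1) else 0 := by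
  simp only [iterate_f132_cons_concat n l hl]
  by_cases hall : ∀ a ∈ l, a = true
  · have hT := iterate_f132_of_forall n l hl hall
    simp only [imp_iff_right hall, if_pos hall, hT, Fintype.sum_bool]
    obtain rfl : l = List.replicate (2 * n + 1) true := List.eq_replicate_iff.mpr ⟨hl, hall⟩
    simp [List.count_append, List.count_replicate]
    ring
  · simp only [hall, if_false, false_imp_iff, and_true, Fintype.sum_bool]
    split_ifs
    · simp [List.count_append]
      ring
    · simp

theorem rule132_density_step (n : ℕ) (c : ℝ) :
    ∑ b : Fin (2 * (n + 1) + 1) → Bool,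
      (if (blockMap f132)^[n + 1] (List.ofFn b) = [true] then
        c ^ (List.ofFn b).count true * (1 - c) ^ (List.ofFn b).count false else 0) =
    ∑ b : Fin (2 * n + 1) → Bool,
      (if (blockMap f132)^[n] (List.ofFn b) = [true] then
        c ^ (List.ofFn b).count true * (1 - c) ^ (List.ofFn b).count false else 0)
      - 2 * c * (1 - c) * c ^ (2 * n + 1) := by
  refine (sum_ofFn_add_two (2 * n + 1) fun l => if (blockMap f132)^[n + 1] l = [true] then
    c ^ l.count true * (1 - c) ^ l.count false else 0).trans ?_
  simp only [sum_ends_f132 n c _ List.length_ofFn, Finset.sum_sub_distrib,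
    List.forall_mem_ofFn_iff]
  congr 1
  have h (b : Fin (2 * n + 1) → Bool) : (∀ j, b j = true) ↔ b = fun _ => true :=
    funext_iff.symm
  simp only [h, Finset.sum_ite_eq', Finset.mem_univ, if_true]

/-- For rule 132, every `n ≥ 0` and every `c₀ ∈ [0,1]`, the density of ones after
`n` iterations starting from a Bernoulli distribution with density `c₀` is
`c_n = (1-c₀)²c₀ + (1-c₀)c₀³/(1+c₀) + (2c₀/(1+c₀))·c₀^{2n+1}`. -/
theorem rule132_density (n : ℕ) (c₀ : ℝ) (h0 : 0 ≤ c₀) (h1 : c₀ ≤ 1) :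
    ∑ b ∈ Finset.univ.filter
        (fun b : Fin (2*n+1) → Bool => (blockMap f132)^[n] (List.ofFn b) = [true]),
      c₀ ^ (List.ofFn b).count true * (1 - c₀) ^ (List.ofFn b).count false
    = (1 - c₀)^2 * c₀ + (1 - c₀) * c₀^3 / (1 + c₀)
      + (2 * c₀ / (1 + c₀)) * c₀ ^ (2*n+1) := by
  have hc : 1 + c₀ ≠ 0 := by positivity
  rw [Finset.sum_filter]
  induction n with
  | zero =>
    rw [← (Equiv.funUnique (Fin 1) Bool).symm.sum_comp]
    simp
    field_simp
    ring
  | succ n ih =>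
    rw [rule132_density_step, ih]
    field_simp
    ring
end

section
/- For elementary cellular automaton rule 172 and every n ≥ 1, the density of ones after n iterations starting from the symmetric Bernoulli distribution (density 1/2) satisfies Σ_{b ∈ 𝐟₁₇₂⁻ⁿ(1)} (1/2)^{2n+1} = 1/8 + ((10−4√5)(1−√5)ⁿ + (10+4√5)(1+√5)ⁿ)/(40·2^{2n}). -/
/-- Local rule 172: `f₁₇₂(1,1,1) = f₁₇₂(1,0,1) = f₁₇₂(0,1,1) = f₁₇₂(0,1,0) = 1`,
and `0` otherwise. -/
def f172 (x₁ x₂ x₃ : Bool) : Bool := (x₁ && x₂ && x₃) || (x₁ && !x₂ && x₃) || (!x₁ && x₂)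

/-- The word has no two adjacent zeros and does not end in `110`
(only meaningful for length at least three). -/
def isGood : List Bool → Bool
  | [a, b, c] => (a || b) && (b || c) && !(a && b && !c)
  | a :: b :: rest => (a || b) && isGood (b :: rest)
  | _ => false

/-- The word starts with `001`. -/
def startsWith001 : List Bool → Bool
  | a :: b :: c :: _ => !a && !b && c
  | _ => false

/-- The number of binary words of length `m` satisfying `p`. -/
def wordCount (m : ℕ) (p : List Bool → Bool) : ℕ :=
  (Finset.univ.filter (fun b : Fin m → Bool => p (List.ofFn b) = true)).card

theorem isGood_cons (a b c d : Bool) (l : List Bool) :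
    isGood (a :: b :: c :: d :: l) = ((a || b) && isGood (b :: c :: d :: l)) := rfl

theorem isGood_blockMap (l : List Bool) (a b c d e g : Bool) :
    isGood (blockMap f172 (a :: b :: c :: d :: e :: g :: l)) =
      isGood (b :: c :: d :: e :: g :: l) := by
  induction l generalizing a b c d e g with
  | nil => revert a b c d e g; decide
  | cons i l ih =>
    have h := ih b c d e g i
    simp only [blockMap] at h ⊢
    rw [isGood_cons, h, isGood_cons b c d e]
    cases c <;> cases d <;> cases a <;> cases b <;> simp [f172, isGood]

theorem startsWith001_blockMap (l : List Bool) (a b c d e : Bool) :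
    startsWith001 (blockMap f172 (a :: b :: c :: d :: e :: l)) =
      startsWith001 (b :: c :: d :: e :: l) := by
  simp only [blockMap, startsWith001]
  revert a b c d e; decide

theorem drop_blockMap (f : Bool → Bool → Bool → Bool) (k : ℕ) (l : List Bool) :
    (blockMap f l).drop k = blockMap f (l.drop k) := by
  induction k generalizing l with
  | zero => rfl
  | succ k ih =>
    match l with
    | [] => simp [blockMap]
    | [_] => simp [blockMap]
    | [_, _] =>
      cases k <;> simp [blockMap]
    | a :: b :: c :: rest => simpa [blockMap] using ih (b :: c :: rest)

theorem iterate_blockMap_eq_true (k : ℕ) (l : List Bool) (hl : l.length = 2 * k + 5) :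
    (blockMap f172)^[k + 2] l = [true] ↔
      (startsWith001 (l.drop k) || isGood (l.drop k)) = true := by
  induction k generalizing l with
  | zero =>
    match l, hl with
    | [a, b, c, d, e], _ => revert a b c d e; decide
  | succ k ih =>
    rw [Function.iterate_succ_apply, ih _ (by rw [length_blockMap]; omega), drop_blockMap]
    have hd : (l.drop k).length = k + 7 := by rw [List.length_drop]; omega
    have hs : l.drop (k + 1) = (l.drop k).drop 1 := by rw [List.drop_drop]
    rw [hs]
    match l.drop k, hd with
    | a :: b :: c :: d :: e :: g :: t, _ =>
      rw [startsWith001_blockMap, isGood_blockMap]; rfl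

theorem wordCount_congr {m : ℕ} {p q : List Bool → Bool}
    (h : ∀ l : List Bool, l.length = m → p l = q l) : wordCount m p = wordCount m q := by
  unfold wordCount
  congr 1
  ext b
  simp [h (List.ofFn b) (by simp)]

theorem wordCount_succ (m : ℕ) (p : List Bool → Bool) :
    wordCount (m + 1) p =
      wordCount m (fun l => p (true :: l)) + wordCount m (fun l => p (false :: l)) := by
  unfold wordCount
  simp only [Finset.card_filter]
  rw [← (Fin.consEquiv (fun _ : Fin (m + 1) => Bool)).sum_comp, Fintype.sum_prod_type]
  simp [Fin.consEquiv, List.ofFn_succ]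

theorem wordCount_drop (k m : ℕ) (p : List Bool → Bool) :
    wordCount (m + k) (fun l => p (l.drop k)) = 2 ^ k * wordCount m p := by
  induction k with
  | zero => simp
  | succ k ih =>
    rw [← add_assoc, wordCount_succ]
    simp only [List.drop_succ_cons]
    rw [ih]; ring

theorem wordCount_false (m : ℕ) : wordCount m (fun _ => false) = 0 := by
  simp [wordCount]

theorem wordCount_true (m : ℕ) : wordCount m (fun _ => true) = 2 ^ m := by
  simp [wordCount]

theorem wordCount_isGood (m : ℕ) :
    wordCount (m + 2) (fun l => isGood (true :: l)) = 2 * Nat.fib (m + 2) ∧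
      wordCount (m + 2) (fun l => isGood (false :: l)) = 2 * Nat.fib (m + 1) := by
  induction m with
  | zero => decide
  | succ m ih =>
    have ht : wordCount (m + 3) (fun l => isGood (true :: l)) =
        wordCount (m + 3) isGood := wordCount_congr fun l hl => by
      match l, hl with
      | a :: b :: c :: t, _ => simp [isGood_cons]
    have hf : wordCount (m + 3) (fun l => isGood (false :: l)) =
        wordCount (m + 3) (fun l => l.headD false && isGood l) := wordCount_congr fun l hl => by
      match l, hl with
      | a :: b :: c :: t, _ => simp [isGood_cons]
    constructor
    · rw [show m + 1 + 2 = m + 3 from rfl, ht, wordCount_succ (m + 2), ih.1, ih.2,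
        Nat.fib_add_two (n := m + 1)]
      ring
    · rw [show m + 1 + 2 = m + 3 from rfl, hf, wordCount_succ (m + 2)]
      simp [wordCount_false, ih.1]

theorem wordCount_startsWith001_or_isGood (m : ℕ) :
    wordCount (m + 3) (fun l => startsWith001 l || isGood l) = 2 ^ m + 2 * Nat.fib (m + 3) := by
  have hg := wordCount_isGood m
  have key : wordCount (m + 3) (fun l => startsWith001 l || isGood l) =
      wordCount (m + 3) startsWith001 + wordCount (m + 3) isGood := by
    unfold wordCount
    rw [← Finset.card_union_of_disjoint, ← Finset.filter_or]
    · simp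
    · rw [Finset.disjoint_filter]
      intro b _ h1 h2
      generalize List.ofFn b = l at h1 h2
      match l with
      | [a, b, c] => revert a b c; decide
      | a :: b :: c :: d :: t => cases a <;> cases b <;> simp_all [startsWith001, isGood]
  have h1 : wordCount (m + 3) startsWith001 = 2 ^ m := by
    simp [wordCount_succ, startsWith001, wordCount_false, wordCount_true]
  rw [key, h1, wordCount_succ (m + 2), hg.1, hg.2, Nat.fib_add_two (n := m + 1)]
  ring

theorem wordCount_iterate_blockMap (k : ℕ) :
    wordCount (2 * (k + 1) + 1) (fun l => decide ((blockMap f172)^[k + 1] l = [true])) =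
      4 ^ k + 2 ^ k * Nat.fib (k + 4) := by
  cases k with
  | zero => decide
  | succ k =>
    have h : wordCount (2 * (k + 1 + 1) + 1)
        (fun l => decide ((blockMap f172)^[k + 1 + 1] l = [true])) =
        wordCount (k + 2 + 3 + k)
          (fun l => startsWith001 (l.drop k) || isGood (l.drop k)) := by
      rw [show 2 * (k + 1 + 1) + 1 = k + 2 + 3 + k by ring]
      refine wordCount_congr fun l hl => ?_
      rw [Bool.eq_iff_iff, decide_eq_true_iff]
      exact iterate_blockMap_eq_true k l (by omega)
    rw [h, wordCount_drop k (k + 2 + 3) (fun l => startsWith001 l || isGood l),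
      wordCount_startsWith001_or_isGood, show (4 : ℕ) = 2 ^ 2 by norm_num, ← pow_mul]
    ring_nf

theorem fib_add_three_eq (n : ℕ) :
    (10 - 4 * Real.sqrt 5) * (1 - Real.sqrt 5) ^ n +
      (10 + 4 * Real.sqrt 5) * (1 + Real.sqrt 5) ^ n = 10 * 2 ^ n * (Nat.fib (n + 3) : ℝ) := by
  have h5 : Real.sqrt 5 ^ 2 = 5 := Real.sq_sqrt (by norm_num)
  induction n using Nat.twoStepInduction with
  | zero => norm_num [Nat.fib]
  | one => norm_num [Nat.fib]; linear_combination 8 * h5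
  | more n h0 h1 =>
    rw [show n + 2 + 3 = n + 3 + 2 by ring, Nat.fib_add_two]
    push_cast
    linear_combination (4 : ℝ) * h0 + 2 * h1 +
      ((10 - 4 * Real.sqrt 5) * (1 - Real.sqrt 5) ^ n +
        (10 + 4 * Real.sqrt 5) * (1 + Real.sqrt 5) ^ n) * h5

/-- For rule 172 and every `n ≥ 1`, the density of ones after `n` iterations
starting from the symmetric Bernoulli distribution (density `1/2`) is
`Σ_{b ∈ 𝐟₁₇₂⁻ⁿ(1)} (1/2)^{2n+1}
  = 1/8 + ((10-4√5)(1-√5)ⁿ + (10+4√5)(1+√5)ⁿ)/(40·2^{2n})`. -/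
theorem rule172_density_symmetric (n : ℕ) (hn : 1 ≤ n) :
    ∑ _b ∈ Finset.univ.filter
        (fun b : Fin (2*n+1) → Bool => (blockMap f172)^[n] (List.ofFn b) = [true]),
      ((1:ℝ)/2) ^ (2*n+1)
    = 1/8 + ((10 - 4*Real.sqrt 5) * (1 - Real.sqrt 5)^n
             + (10 + 4*Real.sqrt 5) * (1 + Real.sqrt 5)^n) / (40 * 2^(2*n)) := by
  obtain ⟨k, rfl⟩ : ∃ k, n = k + 1 := ⟨n - 1, by omega⟩
  have hc := wordCount_iterate_blockMap k
  simp only [wordCount, decide_eq_true_eq] at hc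
  rw [Finset.sum_const, nsmul_eq_mul, fib_add_three_eq, hc]
  have h4 : (4 : ℝ) ^ k = 2 ^ k * 2 ^ k := by rw [← mul_pow]; norm_num
  push_cast
  rw [h4, one_div, inv_pow, pow_succ, mul_comm 2 (k + 1), pow_mul, pow_succ, pow_succ]
  field_simp
  ring_nf
end

section
/- For elementary cellular automaton rule 32 and every n ≥ 0, there is exactly one n-step preimage of 1, namely the alternating block 1010…101 of length 2n+1; consequently, for the symmetric Bernoulli distribution (density 1/2), the density of ones after n iterations of rule 32 is c_n = 2^{−1−2n}. -/
/-- Local rule 32: `f₃₂(1,0,1) = 1`, and `0` otherwise. -/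
def f32 (x₁ x₂ x₃ : Bool) : Bool := x₁ && !x₂ && x₃

/-- The alternating block `1010…101` with `n + 1` ones. -/
def alternatingBlock : ℕ → List Bool
  | 0 => [true]
  | n + 1 => true :: false :: alternatingBlock n

theorem alternatingBlock_eq_ofFn (n : ℕ) :
    alternatingBlock n = List.ofFn (fun i : Fin (2 * n + 1) => decide (i.val % 2 = 0)) := by
  induction n with
  | zero => rfl
  | succ n ih =>
    change _ = List.ofFn (fun i : Fin (2 * n + 1 + 1 + 1) => decide (i.val % 2 = 0))
    rw [List.ofFn_succ, List.ofFn_succ, alternatingBlock, ih]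
    simp [Nat.add_assoc]

theorem blockMap_f32_eq_alternatingBlock_iff (n : ℕ) (l : List Bool) :
    blockMap f32 l = alternatingBlock n ↔ l = alternatingBlock (n + 1) := by
  induction n generalizing l with
  | zero =>
    rcases l with _ | ⟨a, _ | ⟨b, _ | ⟨c, _ | ⟨d, l⟩⟩⟩⟩ <;>
      simp [blockMap, alternatingBlock, f32, and_assoc]
  | succ n ih =>
    rcases l with _ | ⟨a, _ | ⟨b, _ | ⟨c, _ | ⟨d, l⟩⟩⟩⟩
    case cons.cons.cons.cons =>
      have h := ih (c :: d :: l)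
      simp only [blockMap, alternatingBlock, List.cons.injEq] at h ⊢
      rw [h]
      cases a <;> cases b <;> cases c <;> simp [f32]
    all_goals simp [blockMap, alternatingBlock]

theorem iterate_blockMap_f32_eq_singleton_iff (n : ℕ) (l : List Bool) :
    (blockMap f32)^[n] l = [true] ↔ l = alternatingBlock n := by
  induction n generalizing l with
  | zero => rfl
  | succ n ih =>
    rw [Function.iterate_succ_apply, ih, blockMap_f32_eq_alternatingBlock_iff]

theorem iterate_blockMap_f32_ofFn_iff (n : ℕ) (b : Fin (2 * n + 1) → Bool) :
    (blockMap f32)^[n] (List.ofFn b) = [true] ↔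
      b = fun i : Fin (2 * n + 1) => decide (i.val % 2 = 0) := by
  rw [iterate_blockMap_f32_eq_singleton_iff, alternatingBlock_eq_ofFn,
    List.ofFn_injective.eq_iff]


/-- For rule 32 and every `n ≥ 0`, the unique `n`-step preimage of `1` is the
alternating block `1010…101` of length `2n+1` (ones exactly at even 0-based
positions); consequently, for the symmetric Bernoulli distribution the density
of ones after `n` iterations is `c_n = card 𝐟₃₂⁻ⁿ(1) · 2^{-(2n+1)} = 2^{-1-2n}`. -/
theorem rule32_density (n : ℕ) :
    (∀ b : Fin (2*n+1) → Bool,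
      (blockMap f32)^[n] (List.ofFn b) = [true] ↔
        ∀ i : Fin (2*n+1), b i = decide (i.val % 2 = 0)) ∧
    ((Finset.univ.filter
        (fun b : Fin (2*n+1) → Bool =>
          (blockMap f32)^[n] (List.ofFn b) = [true])).card : ℝ)
      * (2:ℝ) ^ (-(2*(n:ℤ)+1)) = (2:ℝ) ^ (-1-2*(n:ℤ)) := by
  refine ⟨fun b => (iterate_blockMap_f32_ofFn_iff n b).trans funext_iff, ?_⟩
  simp only [iterate_blockMap_f32_ofFn_iff, Finset.filter_eq', Finset.mem_univ, if_true,
    Finset.card_singleton, Nat.cast_one, one_mul]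
  congr 1
  ring
end

section
/- For elementary cellular automaton rule 77 and every n ≥ 0, the number of n-step preimages of 1 equals 2^{2n}; consequently, for the symmetric Bernoulli distribution (density 1/2), the density of ones after n iterations of rule 77 is c_n = 1/2 for all n. -/
/-- Local rule 77: `f₇₇(1,1,0) = f₇₇(0,1,1) = f₇₇(0,1,0) = f₇₇(0,0,0) = 1`,
and `0` otherwise. -/
def f77 (x₁ x₂ x₃ : Bool) : Bool :=
  (x₁ && x₂ && !x₃) || (!x₁ && x₂) || (!x₁ && !x₂ && !x₃)

theorem f77_not (x y z : Bool) : f77 (!x) (!y) (!z) = !f77 x y z := by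
  cases x <;> cases y <;> cases z <;> rfl

theorem blockMap_map_not {f : Bool → Bool → Bool → Bool}
    (hf : ∀ x y z, f (!x) (!y) (!z) = !f x y z) (l : List Bool) :
    blockMap f (l.map not) = (blockMap f l).map not := by
  fun_induction blockMap f l with
  | case1 a b c rest ih =>
    simp only [List.map_cons] at ih ⊢
    rw [blockMap, ih, hf]
  | case2 l hl =>
    match l, hl with
    | [], _ => rfl
    | [_], _ => rfl
    | [_, _], _ => rfl
    | a :: b :: c :: rest, hl => exact (hl a b c rest rfl).elim

/-- Complementing a block exchanges the `n`-step preimages of `1` and those of `0`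
whenever the local rule is self-dual. -/
theorem iterate_blockMap_ofFn_not_eq_iff {f : Bool → Bool → Bool → Bool}
    (hf : ∀ x y z, f (!x) (!y) (!z) = !f x y z) (n : ℕ) (b : Fin (2 * n + 1) → Bool) :
    (blockMap f)^[n] (List.ofFn fun i => !b i) = [true] ↔
      ¬ (blockMap f)^[n] (List.ofFn b) = [true] := by
  have hcomm : Function.Commute (blockMap f) (List.map not) := blockMap_map_not hf
  have hmap : (List.ofFn fun i => !b i) = (List.ofFn b).map not := by
    rw [List.map_ofFn]; rfl
  have hlen : ((blockMap f)^[n] (List.ofFn b)).length = 1 := by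
    rw [length_iterate_blockMap, List.length_ofFn]; omega
  rw [hmap, (hcomm.iterate_left n).eq]
  obtain ⟨a, ha⟩ := List.length_eq_one_iff.mp hlen
  rw [ha]
  cases a <;> simp

theorem card_preimages_of_self_dual {f : Bool → Bool → Bool → Bool}
    (hf : ∀ x y z, f (!x) (!y) (!z) = !f x y z) (n : ℕ) :
    (Finset.univ.filter
        (fun b : Fin (2 * n + 1) → Bool =>
          (blockMap f)^[n] (List.ofFn b) = [true])).card = 2 ^ (2 * n) := by
  have hsum := Finset.card_filter_add_card_filter_not (s := Finset.univ)
    (fun b : Fin (2 * n + 1) → Bool => (blockMap f)^[n] (List.ofFn b) = [true])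
  have heq : (Finset.univ.filter
        (fun b : Fin (2 * n + 1) → Bool =>
          (blockMap f)^[n] (List.ofFn b) = [true])).card =
      (Finset.univ.filter
        (fun b : Fin (2 * n + 1) → Bool =>
          ¬ (blockMap f)^[n] (List.ofFn b) = [true])).card := by
    refine Finset.card_nbij' (fun b i => !b i) (fun b i => !b i) ?_ ?_ ?_ ?_
    · intro b hb
      simp only [Finset.coe_filter, Finset.mem_univ, true_and, Set.mem_ofPred_eq] at hb ⊢
      rwa [iterate_blockMap_ofFn_not_eq_iff hf, not_not]
    · intro b hb
      simp only [Finset.coe_filter, Finset.mem_univ, true_and, Set.mem_ofPred_eq] at hb ⊢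
      rwa [iterate_blockMap_ofFn_not_eq_iff hf]
    · intro b _; simp
    · intro b _; simp
  have hcard : (Finset.univ : Finset (Fin (2 * n + 1) → Bool)).card = 2 ^ (2 * n) * 2 := by
    simp [pow_succ]
  omega

/-- For rule 77 and every `n ≥ 0`, the number of `n`-step preimages of `1` is
`2^{2n}`; consequently, for the symmetric Bernoulli distribution, the density of
ones after `n` iterations is `c_n = card 𝐟₇₇⁻ⁿ(1) · 2^{-(2n+1)} = 1/2`. -/
theorem rule77_density (n : ℕ) :
    (Finset.univ.filter
        (fun b : Fin (2*n+1) → Bool =>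
          (blockMap f77)^[n] (List.ofFn b) = [true])).card = 2 ^ (2*n) ∧
    ((Finset.univ.filter
        (fun b : Fin (2*n+1) → Bool =>
          (blockMap f77)^[n] (List.ofFn b) = [true])).card : ℝ)
      * (2:ℝ) ^ (-(2*(n:ℤ)+1)) = 1/2 := by
  have h := card_preimages_of_self_dual f77_not n
  refine ⟨h, ?_⟩
  rw [h, show 2 * (n : ℤ) + 1 = ((2 * n + 1 : ℕ) : ℤ) by push_cast; rfl, zpow_neg,
    zpow_natCast, pow_succ]
  push_cast
  field_simp
end

section
/- Let U_n(p,q) be the sequence of polynomials in two variables defined by U₀(p,q) = p, U₁(p,q) = 2p²q, and U_n(p,q) = p²q(p+q)·U_{n−2}(p,q) + pq·U_{n−1}(p,q) for n ≥ 2. Then for every n ≥ 0, U_n(p,q) = Σ_{k=1}^{n+1} T(n+1,k) p^{2n+2−k} q^{k−1}, where T is the skew triangle associated with the Fibonacci numbers. -/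
/-- The generalized Lucas polynomials associated with rule 40:
`U₀(p,q) = p`, `U₁(p,q) = 2p²q`, and
`Uₙ(p,q) = p²q(p+q)·U_{n-2}(p,q) + pq·U_{n-1}(p,q)` for `n ≥ 2`. -/
noncomputable def U40 : ℕ → ℝ → ℝ → ℝ
  | 0, p, _ => p
  | 1, p, q => 2 * p^2 * q
  | (n+2), p, q => p^2 * q * (p + q) * U40 n p q + p * q * U40 (n+1) p q

theorem skewTriangle_zero_right {T : ℤ → ℤ → ℤ}
    (hT0 : ∀ n k : ℤ, k < 0 ∨ k > n → T n k = 0)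
    (hTrec : ∀ n k : ℤ, 0 ≤ k → k ≤ n → ¬(n = 0 ∧ k = 0) → ¬(n = 2 ∧ k = 1) →
      T n k = T (n-1) (k-1) + T (n-2) (k-1) + T (n-2) (k-2))
    (n : ℤ) (hn : 1 ≤ n) : T n 0 = 0 := by
  rw [hTrec n 0 le_rfl (by lia) (by lia) (by lia), hT0 _ _ (by lia), hT0 _ _ (by lia),
    hT0 _ _ (by lia)]
  simp

/-- An array with `a n 0 = 0`, vanishing above the diagonal and satisfying the skew-triangle
recurrence has row polynomials satisfying the recurrence of `U40`. -/
theorem sum_skewTriangle_add_two {a : ℕ → ℕ → ℝ} (n : ℕ)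
    (hzero : a (n + 1) 0 = 0) (hone : a (n + 3) 1 = 0) (htop : a (n + 1) (n + 2) = 0)
    (hrec : ∀ i ≤ n + 1, a (n + 3) (i + 2) = a (n + 2) (i + 1) + a (n + 1) (i + 1) + a (n + 1) i)
    (p q : ℝ) :
    ∑ j ∈ Finset.range (n + 3), a (n + 3) (j + 1) * p ^ (2 * n + 5 - j) * q ^ j =
      p ^ 2 * q * (p + q) *
          ∑ j ∈ Finset.range (n + 1), a (n + 1) (j + 1) * p ^ (2 * n + 1 - j) * q ^ j +
        p * q * ∑ j ∈ Finset.range (n + 2), a (n + 2) (j + 1) * p ^ (2 * n + 3 - j) * q ^ j := by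
  have hsplit : ∀ i ∈ Finset.range (n + 2),
      a (n + 3) (i + 1 + 1) * p ^ (2 * n + 5 - (i + 1)) * q ^ (i + 1) =
        p * q * (a (n + 2) (i + 1) * p ^ (2 * n + 3 - i) * q ^ i) +
          a (n + 1) (i + 1) * p ^ (2 * n + 4 - i) * q ^ (i + 1) +
          a (n + 1) i * p ^ (2 * n + 4 - i) * q ^ (i + 1) := by
    intro i hi
    rw [Finset.mem_range] at hi
    rw [hrec i (by lia), show 2 * n + 5 - (i + 1) = 2 * n + 3 - i + 1 by lia,
      show 2 * n + 4 - i = 2 * n + 3 - i + 1 by lia]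
    ring
  have hsecond : ∑ i ∈ Finset.range (n + 2),
      a (n + 1) (i + 1) * p ^ (2 * n + 4 - i) * q ^ (i + 1) =
        p ^ 3 * q *
          ∑ j ∈ Finset.range (n + 1), a (n + 1) (j + 1) * p ^ (2 * n + 1 - j) * q ^ j := by
    rw [Finset.sum_range_succ, htop, Finset.mul_sum, zero_mul, zero_mul, add_zero]
    refine Finset.sum_congr rfl fun j hj => ?_
    rw [Finset.mem_range] at hj
    rw [show 2 * n + 4 - j = 2 * n + 1 - j + 3 by lia]
    ring
  have hthird : ∑ i ∈ Finset.range (n + 2),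
      a (n + 1) i * p ^ (2 * n + 4 - i) * q ^ (i + 1) =
        p ^ 2 * q ^ 2 *
          ∑ j ∈ Finset.range (n + 1), a (n + 1) (j + 1) * p ^ (2 * n + 1 - j) * q ^ j := by
    rw [Finset.sum_range_succ', hzero, Finset.mul_sum, zero_mul, zero_mul, add_zero]
    refine Finset.sum_congr rfl fun j hj => ?_
    rw [Finset.mem_range] at hj
    rw [show 2 * n + 4 - (j + 1) = 2 * n + 1 - j + 2 by lia]
    ring
  rw [Finset.sum_range_succ', zero_add, hone, zero_mul, zero_mul, add_zero,
    Finset.sum_congr rfl hsplit, Finset.sum_add_distrib, Finset.sum_add_distrib, hsecond, hthird,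
    ← Finset.mul_sum]
  ring

/-- Let `T` be the skew triangle associated with the Fibonacci numbers, i.e. the
integer array with `T n k = 0` if `k < 0` or `k > n`, `T 0 0 = 1`, `T 2 1 = 0`,
and otherwise `T n k = T (n-1) (k-1) + T (n-2) (k-1) + T (n-2) (k-2)`.
Then for every `n ≥ 0`,
`Uₙ(p,q) = Σ_{k=1}^{n+1} T(n+1,k) p^{2n+2-k} q^{k-1}`. -/
theorem rule40_density_polynomial_expansion (T : ℤ → ℤ → ℤ)
    (hT0 : ∀ n k : ℤ, k < 0 ∨ k > n → T n k = 0)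
    (hT1 : T 0 0 = 1) (hT2 : T 2 1 = 0)
    (hTrec : ∀ n k : ℤ, 0 ≤ k → k ≤ n → ¬(n = 0 ∧ k = 0) → ¬(n = 2 ∧ k = 1) →
      T n k = T (n-1) (k-1) + T (n-2) (k-1) + T (n-2) (k-2))
    (n : ℕ) (p q : ℝ) :
    U40 n p q = ∑ k ∈ Finset.Icc 1 (n+1),
      (T ((n:ℤ)+1) (k:ℤ) : ℝ) * p ^ (2*n+2-k) * q ^ (k-1) := by
  have hcol := skewTriangle_zero_right hT0 hTrec
  have hrange : ∀ m : ℕ, ∑ k ∈ Finset.Icc 1 (m+1),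
      (T ((m:ℤ)+1) (k:ℤ) : ℝ) * p ^ (2*m+2-k) * q ^ (k-1) =
      ∑ j ∈ Finset.range (m+1),
        (T ((m+1 : ℕ) : ℤ) ((j+1 : ℕ) : ℤ) : ℝ) * p ^ (2*m+1-j) * q ^ j := by
    intro m
    rw [← Finset.Ico_add_one_right_eq_Icc, Finset.sum_Ico_eq_sum_range]
    refine Finset.sum_congr rfl fun j _ => ?_
    rw [show 2*m+2-(1+j) = 2*m+1-j by lia, Nat.add_sub_cancel_left, add_comm 1 j]
    push_cast
    rfl
  rw [hrange]
  have h11 : T 1 1 = 1 := by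
    rw [hTrec 1 1 (by lia) (by lia) (by lia) (by lia), hT0 (1-2) _ (by lia),
      hT0 (1-2) _ (by lia)]
    simpa using hT1
  have h22 : T 2 2 = 2 := by
    rw [hTrec 2 2 (by lia) (by lia) (by lia) (by lia), hT0 (2-2) (2-1) (by lia)]
    norm_num [h11, hT1]
  induction n using Nat.twoStepInduction with
  | zero => simp [U40, h11]
  | one => simp [U40, Finset.sum_range_succ, h22, hT2]
  | more n ih₀ ih₁ =>
    rw [U40, ih₀, ih₁]
    refine (sum_skewTriangle_add_two (a := fun m k => (T (m : ℤ) (k : ℤ) : ℝ)) n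
      ?_ ?_ ?_ ?_ p q).symm
    · exact_mod_cast hcol _ (by lia)
    · have h := hTrec ((n + 3 : ℕ) : ℤ) 1 (by lia) (by lia) (by lia) (by lia)
      rw [sub_self, hcol _ (by lia), hcol _ (by lia), hT0 _ (1 - 2) (by lia)] at h
      exact_mod_cast h
    · exact_mod_cast hT0 _ _ (by lia)
    · intro i hi
      have h := hTrec ((n + 3 : ℕ) : ℤ) ((i + 2 : ℕ) : ℤ) (by lia) (by lia) (by lia) (by lia)
      rw [show ((n + 3 : ℕ) : ℤ) - 1 = (n + 2 : ℕ) by lia,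
        show ((n + 3 : ℕ) : ℤ) - 2 = (n + 1 : ℕ) by lia,
        show ((i + 2 : ℕ) : ℤ) - 1 = (i + 1 : ℕ) by lia,
        show ((i + 2 : ℕ) : ℤ) - 2 = (i : ℕ) by lia] at h
      exact_mod_cast h
end

section
/- Let T be the skew triangle associated with the Fibonacci numbers and define S_n = Σ_{k=1}^{n} T(n,k) for n ≥ 1. Then S₁ = 1, S₂ = 2, and S_n = S_{n−1} + 2S_{n−2} for all n ≥ 3; consequently S_n = 2^{n−1} for all n ≥ 1, and hence 2^{−2n−1}·S_{n+1} = 2^{−n−1} for all n ≥ 0. -/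
/-- Let `T` be the skew triangle associated with the Fibonacci numbers, i.e. the
integer array with `T n k = 0` if `k < 0` or `k > n`, `T 0 0 = 1`, `T 2 1 = 0`,
and otherwise `T n k = T (n-1) (k-1) + T (n-2) (k-1) + T (n-2) (k-2)`, and let
`S n = Σ_{k=1}^{n} T n k`. Then `S 1 = 1`, `S 2 = 2`,
`S n = S (n-1) + 2·S (n-2)` for `n ≥ 3`; consequently `S n = 2^{n-1}` for `n ≥ 1`
and `2^{-2n-1}·S (n+1) = 2^{-n-1}` for all `n ≥ 0`. -/
theorem rule40_row_sums (T : ℤ → ℤ → ℤ)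
    (hT0 : ∀ n k : ℤ, k < 0 ∨ k > n → T n k = 0)
    (hT1 : T 0 0 = 1) (hT2 : T 2 1 = 0)
    (hTrec : ∀ n k : ℤ, 0 ≤ k → k ≤ n → ¬(n = 0 ∧ k = 0) → ¬(n = 2 ∧ k = 1) →
      T n k = T (n-1) (k-1) + T (n-2) (k-1) + T (n-2) (k-2))
    (S : ℕ → ℤ) (hS : ∀ n : ℕ, S n = ∑ k ∈ Finset.Icc 1 n, T (n:ℤ) (k:ℤ)) :
    S 1 = 1 ∧ S 2 = 2 ∧
    (∀ n : ℕ, 3 ≤ n → S n = S (n-1) + 2 * S (n-2)) ∧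
    (∀ n : ℕ, 1 ≤ n → S n = 2 ^ (n-1)) ∧
    (∀ n : ℕ, ((S (n+1) : ℝ)) * (2:ℝ) ^ (-2*(n:ℤ)-1) = (2:ℝ) ^ (-(n:ℤ)-1)) := by
  have hS' (n : ℕ) : S n = ∑ i ∈ Finset.range n, T n ((i : ℤ) + 1) := by
    rw [hS, Finset.range_eq_Ico, ← Finset.Ico_add_one_right_eq_Icc]
    simpa using (Finset.sum_Ico_add' (fun k : ℕ => T n k) 0 n 1).symm
  have hcol (n : ℤ) (hn : 0 < n) : T n 0 = 0 := by
    rw [hTrec n 0 le_rfl hn.le (by omega) (by omega), hT0 _ _ (by omega),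
      hT0 _ _ (by omega), hT0 _ _ (by omega)]
    rfl
  have h11 : T 1 1 = 1 := by
    rw [hTrec 1 1 (by omega) le_rfl (by omega) (by omega), hT0 (1 - 2) _ (by omega),
      hT0 (1 - 2) _ (by omega)]
    simpa using hT1
  have h22 : T 2 2 = 2 := by
    rw [hTrec 2 2 (by omega) le_rfl (by omega) (by omega), hT0 (2 - 2) (2 - 1) (by omega)]
    norm_num [h11, hT1]
  have hS1 : S 1 = 1 := by simp [hS, h11]
  have hS2 : S 2 = 2 := by
    rw [hS']
    norm_num [Finset.sum_range_succ, hT2, h22]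
  have hrec (m : ℕ) : S (m + 3) = S (m + 2) + 2 * S (m + 1) := by
    have hterm : ∀ i ∈ Finset.range (m + 3), T ((m + 3 : ℕ) : ℤ) ((i : ℤ) + 1) =
        T ((m + 2 : ℕ) : ℤ) i + T ((m + 1 : ℕ) : ℤ) i + T ((m + 1 : ℕ) : ℤ) ((i : ℤ) - 1) := by
      intro i hi
      rw [Finset.mem_range] at hi
      rw [hTrec _ _ (by omega) (by omega) (by omega) (by omega)]
      congr 1
      · congr 1 <;> congr 1 <;> push_cast <;> ring
      · congr 1 <;> push_cast <;> ring
    have hA : ∑ i ∈ Finset.range (m + 3), T ((m + 2 : ℕ) : ℤ) i = S (m + 2) := by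
      rw [Finset.sum_range_succ', hS']
      simp [hcol ((m : ℤ) + 2) (by omega)]
    have hB : ∑ i ∈ Finset.range (m + 3), T ((m + 1 : ℕ) : ℤ) i = S (m + 1) := by
      rw [Finset.sum_range_succ', Finset.sum_range_succ, hS']
      simp [hcol ((m : ℤ) + 1) (by omega), hT0 ((m : ℤ) + 1) ((m : ℤ) + 1 + 1) (by omega)]
    have hC : ∑ i ∈ Finset.range (m + 3), T ((m + 1 : ℕ) : ℤ) ((i : ℤ) - 1) = S (m + 1) := by
      rw [Finset.sum_range_succ', Finset.sum_range_succ', hS']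
      simp [hcol ((m : ℤ) + 1) (by omega), hT0 ((m : ℤ) + 1) (-1) (by omega)]
    rw [hS' (m + 3), Finset.sum_congr rfl hterm, Finset.sum_add_distrib,
      Finset.sum_add_distrib, hA, hB, hC]
    ring
  have hpow (n : ℕ) : S (n + 1) = 2 ^ n := by
    induction n using Nat.twoStepInduction with
    | zero => simpa using hS1
    | one => simpa using hS2
    | more n ih₀ ih₁ =>
      rw [hrec, ih₀, ih₁]
      ring
  refine ⟨hS1, hS2, fun n hn => ?_, fun n hn => ?_, fun n => ?_⟩
  · obtain ⟨m, rfl⟩ := Nat.exists_eq_add_of_le' hn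
    exact hrec m
  · obtain ⟨m, rfl⟩ := Nat.exists_eq_add_of_le' hn
    exact hpow m
  · rw [hpow]
    push_cast
    rw [← zpow_natCast, ← zpow_add₀ two_ne_zero]
    congr 1
    ring
end

section
/- Let U_n(p,q) be the sequence of polynomials in two variables defined by U₀(p,q) = p, U₁(p,q) = p³ + 3p²q, and U_n(p,q) = −pq(p+q)²·U_{n−2}(p,q) + (p² + 3pq + q²)·U_{n−1}(p,q) for n ≥ 2. Then for every n ≥ 0 the polynomial identity (p² + pq + q²)·U_n(p,q) = p²(p+2q)(p+q)^{2n} − (p−q)(pq)^{n+1} holds. -/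
/-- The generalized Lucas polynomials arising as density polynomials of `n`-step
preimages of `1` under rule 232 (the radius-1 majority rule):
`U₀(p,q) = p`, `U₁(p,q) = p³ + 3p²q`, and
`Uₙ(p,q) = -pq(p+q)²·U_{n-2}(p,q) + (p² + 3pq + q²)·U_{n-1}(p,q)` for `n ≥ 2`. -/
noncomputable def U232 : ℕ → ℝ → ℝ → ℝ
  | 0, p, _ => p
  | 1, p, q => p^3 + 3 * p^2 * q
  | (n+2), p, q => -(p * q * (p + q)^2) * U232 n p q
      + (p^2 + 3 * p * q + q^2) * U232 (n+1) p q

/-- For every `n ≥ 0` the polynomial identity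
`(p² + pq + q²)·Uₙ(p,q) = p²(p+2q)(p+q)^{2n} − (p−q)(pq)^{n+1}` holds. -/
theorem rule232_density_polynomial_closed_form (n : ℕ) (p q : ℝ) :
    (p^2 + p*q + q^2) * U232 n p q
      = p^2 * (p + 2*q) * (p + q)^(2*n) - (p - q) * (p*q)^(n+1) := by
  induction n using Nat.twoStepInduction with
  | zero => simp only [U232]; ring
  | one => simp only [U232]; ring
  | more n ih₀ ih₁ =>
    simp only [U232]
    linear_combination
      -(p * q * (p + q)^2) * ih₀ + (p^2 + 3 * p * q + q^2) * ih₁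
end
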